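/- arXiv:1710.07854 — 4 statements merged into one kernel-verified Lean document; each statement's English description precedes it below -/
import Mathlib

section
/- The λ-open topology τ_λ makes (C(X,ℝ^ι),+) a semitopological group (i.e., for every fixed g ∈ C(X,ℝ^ι) the maps f ↦ f+g and f ↦ g+f are continuous) if and only if every member of λ is C_ι-compact in X and λ = λ(C_ι). -/
open Topology Set

/-- The λ-open (set-open) topology on `C(X, ι → ℝ)` generated by the subbasis
`[A, U] = {f | f(A) ⊆ U}` for `A ∈ Λ` and `U` open in `ι → ℝ`. -/
def setOpenTopology {X : Type*} [TopologicalSpace X] (ι : Type*) (Λ : Set (Set X)) :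
    TopologicalSpace C(X, ι → ℝ) :=
  TopologicalSpace.generateFrom
    {S | ∃ A ∈ Λ, ∃ U : Set (ι → ℝ), IsOpen U ∧ S = {f : C(X, ι → ℝ) | Set.MapsTo f A U}}

/-- A subset `B ⊆ X` is `C_ι`-compact in `X` if `f(B)` is compact in `ℝ^ι`
for every continuous `f : X → ℝ^ι`. -/
def CCompactIn {X : Type*} [TopologicalSpace X] (ι : Type*) (B : Set X) : Prop :=
  ∀ f : C(X, ι → ℝ), IsCompact (⇑f '' B)

/-- The family `λ(C_ι)`. -/
def lambdaC {X : Type*} [TopologicalSpace X] (ι : Type*) (Λ : Set (Set X)) : Set (Set X) :=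
  {A | A ∈ Λ ∧ ∀ B ⊆ A, CCompactIn ι B → ∀ U : Set (ι → ℝ), IsOpen U →
    IsOpen[setOpenTopology ι Λ] {f : C(X, ι → ℝ) | Set.MapsTo f B U}}

theorem isOpen_setOf_mapsTo_setOpenTopology {X : Type*} [TopologicalSpace X] {ι : Type*}
    {Λ : Set (Set X)} {A : Set X} (hA : A ∈ Λ) {U : Set (ι → ℝ)} (hU : IsOpen U) :
    IsOpen[setOpenTopology ι Λ] {f : C(X, ι → ℝ) | Set.MapsTo f A U} :=
  TopologicalSpace.isOpen_generateFrom_of_mem ⟨A, hA, U, hU, rfl⟩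

theorem continuous_const_setOpenTopology {X : Type*} [TopologicalSpace X] (ι : Type*)
    (Λ : Set (Set X)) :
    Continuous[inferInstance, setOpenTopology ι Λ]
      (fun c : ι → ℝ => ContinuousMap.const X c) := by
  refine continuous_generateFrom_iff.2 ?_
  rintro _ ⟨A, -, U, hU, rfl⟩
  rcases A.eq_empty_or_nonempty with rfl | ⟨a, ha⟩
  · simp [Set.mapsTo_empty]
  · convert hU using 1
    ext c
    exact ⟨fun h => h ha, fun h _ _ => h⟩

theorem CCompactIn.isCompact_image_real {X : Type*} [TopologicalSpace X] {ι : Type*} [Nonempty ι]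
    {A : Set X} (hA : CCompactIn ι A) (φ : C(X, ℝ)) : IsCompact (φ '' A) := by
  have h := (hA ⟨fun x _ => φ x, by fun_prop⟩).image
    (continuous_apply (Classical.arbitrary ι) : Continuous fun u : ι → ℝ => u _)
  rwa [Set.image_image] at h

theorem CCompactIn.isCompact_image_properSpace {X : Type*} [TopologicalSpace X] {ι : Type*}
    [Nonempty ι] {A : Set X} (hA : CCompactIn ι A) {P : Type*} [MetricSpace P] [ProperSpace P]
    (p : C(X, P)) : IsCompact (p '' A) := by
  have hd (y : P) : IsCompact ((fun x => dist (p x) y) '' A) :=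
    hA.isCompact_image_real ⟨fun x => dist (p x) y, by fun_prop⟩
  refine Metric.isCompact_of_isClosed_isBounded ?_ ?_
  · refine isClosed_of_closure_subset fun y hy => ?_
    have h0 : (0 : ℝ) ∈ (fun x => dist (p x) y) '' A := by
      rw [← (hd y).isClosed.closure_eq]
      have := mem_closure_image (f := fun z => dist z y) (by fun_prop) hy
      rwa [Set.image_image, dist_self] at this
    obtain ⟨x, hx, hxy⟩ := h0
    exact ⟨x, hx, dist_eq_zero.1 hxy⟩
  · rcases A.eq_empty_or_nonempty with rfl | ⟨a, -⟩
    · simp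
    · obtain ⟨C, hC⟩ := (hd (p a)).bddAbove
      refine (Metric.isBounded_closedBall (x := p a) (r := C)).subset ?_
      rintro _ ⟨x, hx, rfl⟩
      exact hC ⟨x, hx, rfl⟩

theorem CCompactIn.isCompact_image_prodMk {X : Type*} [TopologicalSpace X] {ι : Type*} [Nonempty ι]
    {A : Set X} (hA : CCompactIn ι A) (f g : C(X, ι → ℝ)) : IsCompact (f.prodMk g '' A) := by
  rcases finite_or_infinite ι with hι | hι
  · have := Fintype.ofFinite ι
    exact hA.isCompact_image_properSpace _
  · obtain ⟨e⟩ : Nonempty (ι ⊕ ι ≃ ι) := by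
      rw [← Cardinal.eq, ← Cardinal.add_def]
      exact Cardinal.add_mk_eq_self
    have hcont : Continuous fun x i => Sum.elim (f x) (g x) (e.symm i) := by
      refine continuous_pi fun i => ?_
      rcases e.symm i with j | j <;> simp only [Sum.elim_inl, Sum.elim_inr] <;> fun_prop
    have h := (hA ⟨_, hcont⟩).image
      (f := fun u : ι → ℝ => ((fun i => u (e (.inl i)), fun i => u (e (.inr i))) :
        (ι → ℝ) × (ι → ℝ))) (by fun_prop)
    rw [Set.image_image] at h
    simp only [ContinuousMap.coe_mk, Equiv.symm_apply_apply, Sum.elim_inl, Sum.elim_inr] at h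
    exact h

theorem CCompactIn.inter_preimage {X : Type*} [TopologicalSpace X] {ι : Type*} [Nonempty ι]
    {A : Set X} (hA : CCompactIn ι A) (f : C(X, ι → ℝ)) {F : Set (ι → ℝ)} (hF : IsClosed F) :
    CCompactIn ι (A ∩ f ⁻¹' F) := by
  intro h
  convert ((hA.isCompact_image_prodMk h f).inter_right
    (hF.preimage continuous_snd)).image continuous_fst using 1
  ext y
  constructor
  · rintro ⟨x, ⟨hx, hxF⟩, rfl⟩
    exact ⟨_, ⟨⟨x, hx, rfl⟩, hxF⟩, rfl⟩
  · rintro ⟨_, ⟨⟨x, hx, rfl⟩, hxF⟩, rfl⟩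
    exact ⟨x, ⟨hx, hxF⟩, rfl⟩

theorem continuous_add_right_setOpenTopology {X : Type*} [TopologicalSpace X] {ι : Type*}
    [Nonempty ι] {Λ : Set (Set X)} (hc : ∀ A ∈ Λ, CCompactIn ι A) (hΛ : Λ = lambdaC ι Λ)
    (g : C(X, ι → ℝ)) :
    Continuous[setOpenTopology ι Λ, setOpenTopology ι Λ] (fun f => f + g) := by
  refine continuous_generateFrom_iff.2 ?_
  rintro _ ⟨A, hA, U, hU, rfl⟩
  let τ := setOpenTopology (X := X) ι Λ
  refine (@isOpen_iff_mem_nhds _ τ _).2 fun f₀ hf₀ => ?_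
  have hcover := (hc A hA).isCompact_image_prodMk f₀ g |>.induction_on
    (p := fun S => ∀ᶠ f in @nhds _ τ f₀, ∀ x ∈ A, (f₀ x, g x) ∈ S → f x + g x ∈ U)
    (by simp)
    (fun s t hst ht => ht.mono fun f hf x hx hxs => hf x hx (hst hxs))
    (fun s t hs ht => (hs.and ht).mono fun f hf x hx hxs =>
      hxs.elim (hf.1 x hx) (hf.2 x hx)) ?_
  · filter_upwards [hcover] with f hf x hx using hf x hx ⟨x, hx, rfl⟩
  · rintro _ ⟨a, ha, rfl⟩
    have hW : (fun p : (ι → ℝ) × (ι → ℝ) => p.1 + p.2) ⁻¹' U ∈ 𝓝 (f₀ a, g a) :=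
      (hU.preimage continuous_add).mem_nhds (hf₀ ha)
    obtain ⟨V, Z, hVo, haV, hZo, haZ, hVZ⟩ := mem_nhds_prod_iff'.1 hW
    obtain ⟨C, hCn, hCc, hCV⟩ := exists_mem_nhds_isClosed_subset (hVo.mem_nhds haV)
    obtain ⟨D, hDn, hDc, hDZ⟩ := exists_mem_nhds_isClosed_subset (hZo.mem_nhds haZ)
    refine ⟨C ×ˢ D, mem_nhdsWithin_of_mem_nhds (prod_mem_nhds hCn hDn), ?_⟩
    have hopen := (hΛ ▸ hA : A ∈ lambdaC ι Λ).2 ((A ∩ f₀ ⁻¹' C) ∩ g ⁻¹' D)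
      (fun x hx => hx.1.1) (((hc A hA).inter_preimage f₀ hCc).inter_preimage g hDc) V hVo
    have hmem : f₀ ∈ {f : C(X, ι → ℝ) | Set.MapsTo f ((A ∩ f₀ ⁻¹' C) ∩ g ⁻¹' D) V} :=
      fun x hx => hCV hx.1.2
    filter_upwards [(@isOpen_iff_mem_nhds _ τ _).1 hopen f₀ hmem] with f hf x hx hxS
    exact hVZ (Set.mk_mem_prod (hf ⟨⟨hx, hxS.1⟩, hxS.2⟩) (hDZ hxS.2))

theorem isOpen_setOf_mapsTo_add_const {X : Type*} [TopologicalSpace X] {ι : Type*}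
    {Λ : Set (Set X)}
    (hadd : ∀ g : C(X, ι → ℝ),
      Continuous[setOpenTopology ι Λ, setOpenTopology ι Λ] (fun f => f + g))
    {A : Set X} (hA : A ∈ Λ) (f : C(X, ι → ℝ)) {U : Set (ι → ℝ)} (hU : IsOpen U) :
    IsOpen {c : ι → ℝ | ∀ x ∈ A, c + f x ∈ U} :=
  (@continuous_def _ _ _ (setOpenTopology ι Λ) _).1
    (continuous_const_setOpenTopology ι Λ) _
    ((@continuous_def _ _ (setOpenTopology ι Λ) (setOpenTopology ι Λ) _).1 (hadd f) _
      (isOpen_setOf_mapsTo_setOpenTopology hA hU))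

theorem cCompactIn_of_continuous_add_right {X : Type*} [TopologicalSpace X] {ι : Type*}
    {Λ : Set (Set X)}
    (hadd : ∀ g : C(X, ι → ℝ),
      Continuous[setOpenTopology ι Λ, setOpenTopology ι Λ] (fun f => f + g))
    {A : Set X} (hA : A ∈ Λ) : CCompactIn ι A := by
  intro f
  have hclosed : IsClosed (f '' A) := by
    refine isClosed_of_closure_subset fun y hy => ?_
    by_contra hyA
    have hV := (isOpen_setOf_mapsTo_add_const hadd hA f
      (isOpen_compl_singleton (x := y))).preimage (continuous_const.sub continuous_id :
        Continuous fun z : ι → ℝ => y - z)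
    obtain ⟨_, hz, x, hx, rfl⟩ := mem_closure_iff.1 hy _ hV fun x hx hxy =>
      hyA ⟨x, hx, by simpa using hxy⟩
    exact hz x hx (sub_add_cancel _ _)
  have hbdd (i : ι) : ∃ M : ℝ, ∀ x ∈ A, |f x i| ≤ M := by
    have hpos (x : X) : 0 < 1 + |f x i| := by positivity
    let g : C(X, ι → ℝ) := ⟨fun x _ => (1 + |f x i|)⁻¹, continuous_pi fun _ =>
      Continuous.inv₀ (by fun_prop) fun x => (hpos x).ne'⟩
    have hV := (isOpen_setOf_mapsTo_add_const hadd hA g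
      (isOpen_lt continuous_const (continuous_apply i) : IsOpen {u : ι → ℝ | 0 < u i})).preimage
        (continuous_pi fun _ => continuous_neg : Continuous fun (ε : ℝ) (_ : ι) => -ε)
    have h0 : (0 : ℝ) ∈ (fun (ε : ℝ) (_ : ι) => -ε) ⁻¹'
        {c : ι → ℝ | ∀ x ∈ A, c + g x ∈ {u : ι → ℝ | 0 < u i}} := fun x _ => by
      simpa [g] using hpos x
    obtain ⟨ε, hε, hball⟩ := Metric.isOpen_iff.1 hV 0 h0
    have hmem := hball (show ε / 2 ∈ Metric.ball (0 : ℝ) ε by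
      rw [Metric.mem_ball, Real.dist_0_eq_abs, abs_of_pos (by positivity)]; linarith)
    refine ⟨(ε / 2)⁻¹, fun x hx => ?_⟩
    have h : 0 < -(ε / 2) + (1 + |f x i|)⁻¹ := hmem x hx
    have := (lt_inv_comm₀ (by positivity) (hpos x)).1 (by linarith : ε / 2 < (1 + |f x i|)⁻¹)
    linarith
  choose M hM using hbdd
  refine (isCompact_univ_pi fun i => isCompact_Icc (a := -M i) (b := M i)).of_isClosed_subset
    hclosed ?_
  rintro _ ⟨x, hx, rfl⟩ i -
  exact abs_le.1 (hM i x hx)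

theorem isOpen_setOf_mapsTo_of_cCompactIn {X : Type*} [TopologicalSpace X] {ι : Type*}
    {Λ : Set (Set X)}
    (hadd : ∀ g : C(X, ι → ℝ),
      Continuous[setOpenTopology ι Λ, setOpenTopology ι Λ] (fun f => f + g))
    {A B : Set X} (hA : A ∈ Λ) (hBA : B ⊆ A) (hB : CCompactIn ι B)
    {U : Set (ι → ℝ)} (hU : IsOpen U) :
    IsOpen[setOpenTopology ι Λ] {f : C(X, ι → ℝ) | Set.MapsTo f B U} := by
  let τ := setOpenTopology (X := X) ι Λ
  refine (@isOpen_iff_mem_nhds _ τ _).2 fun f hf => ?_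
  obtain ⟨V, hV, hVU⟩ := compact_open_separated_add_right (hB f) hU
    (Set.mapsTo_iff_image_subset.1 hf)
  have hopen := (isOpen_setOf_mapsTo_setOpenTopology hA
    (isOpen_interior (s := V))).preimage (hadd (-f))
  have hmem : f ∈ (fun h => h + -f) ⁻¹' {h : C(X, ι → ℝ) | Set.MapsTo h A (interior V)} :=
    fun x _ => by simpa using mem_interior_iff_mem_nhds.2 hV
  filter_upwards [(@isOpen_iff_mem_nhds _ τ _).1 hopen f hmem] with h hh x hx
  have := hVU (Set.add_mem_add ⟨x, hx, rfl⟩ (interior_subset (hh (hBA hx))))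
  simpa using this

theorem statement_0 {X : Type*} [TopologicalSpace X] [T35Space X]
    (ι : Type*) [Nonempty ι] (Λ : Set (Set X)) (hΛ : ∀ A ∈ Λ, A.Nonempty) :
    (∀ g : C(X, ι → ℝ),
      Continuous[setOpenTopology ι Λ, setOpenTopology ι Λ] (fun f => f + g) ∧
      Continuous[setOpenTopology ι Λ, setOpenTopology ι Λ] (fun f => g + f)) ↔
    (∀ A ∈ Λ, CCompactIn ι A) ∧ Λ = lambdaC ι Λ := by
  constructor
  · intro h
    have hadd := fun g => (h g).1
    refine ⟨fun A hA => cCompactIn_of_continuous_add_right hadd hA,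
      Set.Subset.antisymm (fun A hA => ⟨hA, fun B hBA hB U hU => ?_⟩) fun A hA => hA.1⟩
    exact isOpen_setOf_mapsTo_of_cCompactIn hadd hA hBA hB hU
  · rintro ⟨hc, hl⟩ g
    have hg := continuous_add_right_setOpenTopology hc hl g
    refine ⟨hg, ?_⟩
    simpa only [add_comm g] using hg
end

section
/- The λ-open topology τ_λ makes (C(X,ℝ^ι),+) a topological group (i.e., addition (f,g) ↦ f+g is jointly continuous and negation f ↦ −f is continuous) if and only if every member of λ is C_ι-compact in X and λ = λ(C_ι). -/
open Topology Set

namespace SetOpen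

variable {X : Type*} [TopologicalSpace X] {ι : Type*} {Λ : Set (Set X)} {A : Set X}

theorem isOpen_mapsTo (hA : A ∈ Λ) {U : Set (ι → ℝ)} (hU : IsOpen U) :
    IsOpen[setOpenTopology ι Λ] {f : C(X, ι → ℝ) | MapsTo f A U} :=
  TopologicalSpace.isOpen_generateFrom_of_mem ⟨A, hA, U, hU, rfl⟩

theorem continuous_const' :
    @Continuous _ _ _ (setOpenTopology ι Λ)
      (fun c : ι → ℝ => (ContinuousMap.const X c : C(X, ι → ℝ))) := by
  refine continuous_generateFrom_iff.2 ?_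
  rintro _ ⟨A, -, U, hU, rfl⟩
  rcases A.eq_empty_or_nonempty with rfl | ⟨x, hx⟩
  · simp [mapsTo_empty]
  · convert hU using 1
    ext c
    exact ⟨fun h => h hx, fun h _ _ => h⟩

/-- Every continuous image of `A ∈ Λ` is closed when translations are continuous. -/
theorem isClosed_image
    (hT : ∀ f : C(X, ι → ℝ), Continuous[setOpenTopology ι Λ, setOpenTopology ι Λ] (· + f))
    (hA : A ∈ Λ) (f : C(X, ι → ℝ)) : IsClosed (f '' A) := by
  refine isClosed_of_closure_subset fun p hp => ?_
  by_contra hpA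
  have hN : IsOpen {c : ι → ℝ | MapsTo (ContinuousMap.const X c + f) A {p}ᶜ} :=
    let _ := setOpenTopology (X := X) ι Λ
    ((isOpen_mapsTo hA isOpen_compl_singleton).preimage (hT f)).preimage continuous_const'
  have hN' := hN.preimage (continuous_const.sub continuous_id : Continuous fun s => p - s)
  obtain ⟨_, hs, x, hx, rfl⟩ := mem_closure_iff.1 hp _ hN' (by
    rintro x hx h
    exact hpA ⟨x, hx, by simpa using h⟩)
  exact hs hx (by simp)

theorem cCompactIn_of_isClosed_image [Nonempty ι]
    (h : ∀ f : C(X, ι → ℝ), IsClosed (f '' A)) : CCompactIn ι A := by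
  intro f
  have hb : ∀ i, ∃ M, ∀ x ∈ A, |f x i| ≤ M := by
    intro i
    let k : C(X, ι → ℝ) :=
      ⟨fun x _ => (1 + |f x i|)⁻¹, continuous_pi fun _ => by
        have : Continuous fun x => 1 + |f x i| := by fun_prop
        exact this.inv₀ fun x => by positivity⟩
    have hO : IsOpen {t : ℝ | (fun _ => t) ∉ k '' A} :=
      (h k).isOpen_compl.preimage (continuous_pi fun _ : ι => continuous_id)
    have h0 : (0 : ℝ) ∈ {t : ℝ | (fun _ => t) ∉ k '' A} := by
      rintro ⟨x, -, hx⟩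
      have := congrFun hx (Classical.arbitrary ι)
      have hpos : 0 < (1 + |f x i|)⁻¹ := by positivity
      exact hpos.ne' this
    obtain ⟨ε, hε, hball⟩ := Metric.isOpen_iff.1 hO 0 h0
    refine ⟨ε⁻¹, fun x hx => ?_⟩
    by_contra! hlt
    have hpos : 0 < (1 + |f x i|)⁻¹ := by positivity
    refine hball (a := (1 + |f x i|)⁻¹) ?_ ⟨x, hx, rfl⟩
    rw [mem_ball_zero_iff, Real.norm_of_nonneg hpos.le]
    exact inv_lt_of_inv_lt₀ hε (by linarith)
  choose M hM using hb
  refine (isCompact_univ_pi fun i => isCompact_Icc (a := -M i) (b := M i)).of_isClosed_subset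
    (h f) ?_
  rintro _ ⟨x, hx, rfl⟩ i -
  exact abs_le.1 (hM i x hx)

end SetOpen

namespace CCompactIn

variable {X : Type*} [TopologicalSpace X] {ι : Type*} [Nonempty ι] {A : Set X}

theorem isCompact_image_real_s3 (hA : CCompactIn ι A) (g : C(X, ℝ)) : IsCompact (g '' A) := by
  have := (hA ⟨fun x _ => g x, continuous_pi fun _ => g.continuous⟩).image
    (continuous_apply (Classical.arbitrary ι))
  rwa [image_image] at this

theorem isCompact_image_prod (hA : CCompactIn ι A) (h : C(X, ι → ℝ)) (g : C(X, ℝ)) :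
    IsCompact ((fun x => (h x, g x)) '' A) := by
  cases finite_or_infinite ι
  · have := Fintype.ofFinite ι
    refine ((hA h).prod (hA.isCompact_image_real_s3 g)).of_isClosed_subset ?_ ?_
    · refine isClosed_of_closure_subset fun p hp => ?_
      let d : C(X, ℝ) := ⟨fun x => dist (h x, g x) p, by fun_prop⟩
      have h0 : (0 : ℝ) ∈ closure (d '' A) := by
        refine Metric.mem_closure_iff.2 fun ε hε => ?_
        obtain ⟨_, ⟨x, hx, rfl⟩, hlt⟩ := Metric.mem_closure_iff.1 hp ε hε
        refine ⟨_, ⟨x, hx, rfl⟩, ?_⟩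
        rw [dist_comm] at hlt
        simpa [d] using hlt
      rw [(hA.isCompact_image_real_s3 d).isClosed.closure_eq] at h0
      obtain ⟨x, hx, hd⟩ := h0
      exact ⟨x, hx, dist_eq_zero.1 hd⟩
    · rintro _ ⟨x, hx, rfl⟩
      exact ⟨⟨x, hx, rfl⟩, ⟨x, hx, rfl⟩⟩
  · obtain ⟨e⟩ : Nonempty (Option ι ≃ ι) := by
      rw [← Cardinal.eq, Cardinal.mk_option]
      exact Cardinal.add_one_eq (Cardinal.aleph0_le_mk ι)
    let k : C(X, ι → ℝ) :=
      ⟨fun x i => (e.symm i).elim (g x) (h x), continuous_pi fun i => by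
        cases e.symm i
        · exact g.continuous
        · exact (continuous_apply _).comp h.continuous⟩
    have hc : Continuous fun u : ι → ℝ => ((fun i => u (e (some i))), u (e none)) := by
      fun_prop
    have := (hA k).image hc
    rw [image_image] at this
    simpa [k] using this

theorem inter_preimage_s3 (hA : CCompactIn ι A) (g : C(X, ℝ)) {C : Set ℝ} (hC : IsClosed C) :
    CCompactIn ι (A ∩ g ⁻¹' C) := by
  intro h
  have := ((hA.isCompact_image_prod h g).inter_right (hC.preimage continuous_snd)).image
    continuous_fst
  convert this using 1
  ext y
  constructor
  · rintro ⟨x, ⟨hx, hxC⟩, rfl⟩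
    exact ⟨_, ⟨⟨x, hx, rfl⟩, hxC⟩, rfl⟩
  · rintro ⟨_, ⟨⟨x, hx, rfl⟩, hxC⟩, rfl⟩
    exact ⟨x, ⟨hx, hxC⟩, rfl⟩

end CCompactIn

namespace SetOpen

variable {X : Type*} [TopologicalSpace X] {ι : Type*} {Λ : Set (Set X)} {A : Set X}

/-- A set-open topology refines uniform convergence on `A ∈ λ(C_ι)` if `A` is `C_ι`-compact. -/
theorem exists_isOpen_forall_sub_mem [Nonempty ι] (hA : A ∈ lambdaC ι Λ) (hc : CCompactIn ι A)
    (f : C(X, ι → ℝ)) {V : Set (ι → ℝ)} (hV : V ∈ 𝓝 0) :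
    ∃ O, IsOpen[setOpenTopology ι Λ] O ∧ f ∈ O ∧ ∀ f' ∈ O, ∀ x ∈ A, f' x - f x ∈ V := by
  obtain ⟨W, hWo, hW0, hWV⟩ : ∃ W : Set (ι → ℝ), IsOpen W ∧ 0 ∈ W ∧
      ∀ a ∈ W, ∀ b ∈ W, a - b ∈ V := by
    have hV' : (fun q : (ι → ℝ) × (ι → ℝ) => q.1 - q.2) ⁻¹' V ∈ 𝓝 ((0 : ι → ℝ), (0 : ι → ℝ)) :=
      (continuous_fst.sub continuous_snd).continuousAt.preimage_mem_nhds (by simpa using hV)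
    rw [mem_nhds_prod_iff'] at hV'
    obtain ⟨W₁, W₂, h₁, m₁, h₂, m₂, hs⟩ := hV'
    exact ⟨W₁ ∩ W₂, h₁.inter h₂, ⟨m₁, m₂⟩, fun a ha b hb => hs (mk_mem_prod ha.1 hb.2)⟩
  obtain ⟨ρ, hρ, hρ0, hρ1⟩ := CompletelyRegularSpace.completely_regular (0 : ι → ℝ) Wᶜ
    hWo.isClosed_compl (by simpa using hW0)
  have hmem : ∀ z, (ρ z : ℝ) ≤ 1 / 2 → z ∈ W := by
    intro z hz
    by_contra hzW
    have h1 : (ρ z : ℝ) = 1 := by rw [hρ1 hzW]; rfl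
    linarith
  obtain ⟨t, ht⟩ := (hc f).elim_finite_subcover
    (fun y : ι → ℝ => {z | (ρ (z - y) : ℝ) < 1 / 2})
    (fun y => isOpen_lt (by fun_prop) continuous_const)
    (fun y _ => mem_iUnion.2 ⟨y, by simp [hρ0]⟩)
  let g : (ι → ℝ) → C(X, ℝ) := fun y => ⟨fun x => (ρ (f x - y) : ℝ), by fun_prop⟩
  refine ⟨⋂ y ∈ t, {f' : C(X, ι → ℝ) |
      MapsTo f' (A ∩ g y ⁻¹' Iic (1 / 2)) ((fun z => z - y) ⁻¹' W)}, ?_, ?_, ?_⟩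
  · let _ := setOpenTopology (X := X) ι Λ
    refine isOpen_biInter_finset fun y _ => ?_
    exact hA.2 _ inter_subset_left (hc.inter_preimage_s3 (g y) isClosed_Iic) _
      (hWo.preimage (by fun_prop))
  · refine mem_iInter₂.2 fun y _ x hx => hmem _ hx.2
  · intro f' hf' x hx
    obtain ⟨y, hy, hlt⟩ := mem_iUnion₂.1 (ht ⟨x, hx, rfl⟩)
    have hle : (ρ (f x - y) : ℝ) ≤ 1 / 2 := le_of_lt hlt
    have h1 := mem_iInter₂.1 hf' y hy (show x ∈ A ∩ g y ⁻¹' Iic (1 / 2) from ⟨hx, hle⟩)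
    simpa using hWV _ h1 _ (hmem _ hle)

/-- A compact subset of an open set has a uniform neighbourhood inside that set. -/
theorem exists_nhds_zero_add_mem {K U : Set (ι → ℝ)} (hK : IsCompact K) (hU : IsOpen U)
    (hKU : K ⊆ U) : ∃ V ∈ 𝓝 (0 : ι → ℝ), ∀ k ∈ K, ∀ v ∈ V, k + v ∈ U := by
  obtain ⟨V, hV, h⟩ := compact_open_separated_add_right hK hU hKU
  exact ⟨V, hV, fun k hk v hv => h (add_mem_add hk hv)⟩

theorem continuous_add_of_lambdaC [Nonempty ι] (hc : ∀ A ∈ Λ, CCompactIn ι A)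
    (hΛ : Λ = lambdaC ι Λ) :
    Continuous[@instTopologicalSpaceProd _ _ (setOpenTopology ι Λ) (setOpenTopology ι Λ),
      setOpenTopology ι Λ] (fun p : C(X, ι → ℝ) × C(X, ι → ℝ) => p.1 + p.2) := by
  refine continuous_generateFrom_iff.2 ?_
  rintro _ ⟨A, hA, U, hU, rfl⟩
  let _ := setOpenTopology (X := X) ι Λ
  refine isOpen_prod_iff.2 fun f g hfg => ?_
  obtain ⟨V, hV, hVU⟩ := exists_nhds_zero_add_mem (hc A hA (f + g)) hU hfg.image_subset
  obtain ⟨W, hW, hWV⟩ := exists_nhds_zero_half hV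
  have hA' : A ∈ lambdaC ι Λ := hΛ ▸ hA
  obtain ⟨O₁, ho₁, hf, h₁⟩ := exists_isOpen_forall_sub_mem hA' (hc A hA) f hW
  obtain ⟨O₂, ho₂, hg, h₂⟩ := exists_isOpen_forall_sub_mem hA' (hc A hA) g hW
  refine ⟨O₁, O₂, ho₁, ho₂, hf, hg, ?_⟩
  rintro ⟨f', g'⟩ ⟨hf', hg'⟩ x hx
  have := hVU _ (mem_image_of_mem _ hx) _ (hWV _ (h₁ f' hf' x hx) _ (h₂ g' hg' x hx))
  convert this using 1
  simp only [ContinuousMap.add_apply]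
  abel

theorem continuous_neg' :
    Continuous[setOpenTopology ι Λ, setOpenTopology ι Λ] (fun f : C(X, ι → ℝ) => -f) := by
  refine continuous_generateFrom_iff.2 ?_
  rintro _ ⟨A, hA, U, hU, rfl⟩
  exact isOpen_mapsTo hA (hU.preimage continuous_neg)

theorem isOpen_mapsTo_of_subset
    (hT : ∀ f : C(X, ι → ℝ), Continuous[setOpenTopology ι Λ, setOpenTopology ι Λ] (· + f))
    (hA : A ∈ Λ) {B : Set X} (hBA : B ⊆ A) (hB : CCompactIn ι B) {U : Set (ι → ℝ)}
    (hU : IsOpen U) : IsOpen[setOpenTopology ι Λ] {f : C(X, ι → ℝ) | MapsTo f B U} := by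
  let _ := setOpenTopology (X := X) ι Λ
  refine isOpen_iff_forall_mem_open.2 fun f hf => ?_
  obtain ⟨V, hV, hVU⟩ := exists_nhds_zero_add_mem (hB f) hU hf.image_subset
  obtain ⟨W, hWV, hWo, hW0⟩ := mem_nhds_iff.1 hV
  refine ⟨_, ?_, (isOpen_mapsTo hA hWo).preimage (hT (-f)), ?_⟩
  · intro f' hf' x hx
    have := hVU _ (mem_image_of_mem f hx) _ (hWV (hf' (hBA hx)))
    simpa using this
  · intro x _
    simpa using hW0

end SetOpen

open SetOpen in
theorem statement_3 {X : Type*} [TopologicalSpace X] [T35Space X]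
    (ι : Type*) [Nonempty ι] (Λ : Set (Set X)) (hΛ : ∀ A ∈ Λ, A.Nonempty) :
    (Continuous[@instTopologicalSpaceProd _ _ (setOpenTopology ι Λ) (setOpenTopology ι Λ),
        setOpenTopology ι Λ]
        (fun p : C(X, ι → ℝ) × C(X, ι → ℝ) => p.1 + p.2) ∧
      Continuous[setOpenTopology ι Λ, setOpenTopology ι Λ]
        (fun f : C(X, ι → ℝ) => -f)) ↔
    (∀ A ∈ Λ, CCompactIn ι A) ∧ Λ = lambdaC ι Λ := by
  refine ⟨fun ⟨hadd, _⟩ => ?_, fun ⟨hc, hL⟩ => ⟨continuous_add_of_lambdaC hc hL, continuous_neg'⟩⟩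
  have hT : ∀ f : C(X, ι → ℝ),
      Continuous[setOpenTopology ι Λ, setOpenTopology ι Λ] (· + f) := fun f => by
    let _ := setOpenTopology (X := X) ι Λ
    exact hadd.comp (continuous_id.prodMk continuous_const)
  exact ⟨fun A hA => cCompactIn_of_isClosed_image (isClosed_image hT hA),
    Subset.antisymm (fun A hA => ⟨hA, fun B hBA hB U hU => isOpen_mapsTo_of_subset hT hA hBA hB hU⟩)
      fun A hA => hA.1⟩
end

section
/- The λ-open topology τ_λ on C(X,ℝ^ι) coincides with the topology of uniform convergence on the members of λ (the topology induced on C(X,ℝ^ι) by the uniformity on functions X → ℝ^ι of uniform convergence on each set of λ) if and only if every member of λ is C_ι-compact in X and λ = λ(C_ι). -/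
open Topology Set

open UniformConvergence in
/-- The topology on `C(X, ι → ℝ)` of uniform convergence on the members of `Λ`. -/
abbrev uniformOnTopology {X : Type*} [TopologicalSpace X] (ι : Type*) (Λ : Set (Set X)) :
    TopologicalSpace C(X, ι → ℝ) :=
  TopologicalSpace.induced
    (fun f : C(X, ι → ℝ) => UniformOnFun.ofFun Λ ⇑f)
    (UniformOnFun.topologicalSpace X (ι → ℝ) Λ)

section

open Filter Uniformity

variable {X ι : Type*} [TopologicalSpace X] {Λ : Set (Set X)}

lemma tendsto_uniformOnTopology_iff {β : Type*} {F : β → C(X, ι → ℝ)} {l : Filter β}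
    {f : C(X, ι → ℝ)} :
    Tendsto F l (@nhds _ (uniformOnTopology ι Λ) f) ↔
      ∀ A ∈ Λ, TendstoUniformlyOn (fun b => ⇑(F b)) f l A := by
  rw [nhds_induced, tendsto_comap_iff, UniformOnFun.tendsto_iff_tendstoUniformlyOn]
  rfl

lemma le_uniformOnTopology_iff {t : TopologicalSpace C(X, ι → ℝ)} :
    t ≤ uniformOnTopology ι Λ ↔
      ∀ f : C(X, ι → ℝ), ∀ A ∈ Λ,
        TendstoUniformlyOn (fun g : C(X, ι → ℝ) => ⇑g) f (@nhds _ t f) A := by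
  rw [le_iff_nhds]
  exact forall_congr' fun f => tendsto_uniformOnTopology_iff (F := id)

lemma isOpen_uniformOnTopology_mapsTo {A B : Set X} (hA : A ∈ Λ) (hBA : B ⊆ A)
    (hB : CCompactIn ι B) {U : Set (ι → ℝ)} (hU : IsOpen U) :
    IsOpen[uniformOnTopology ι Λ] {f : C(X, ι → ℝ) | MapsTo f B U} := by
  let _ := uniformOnTopology ι Λ
  refine isOpen_iff_mem_nhds.2 fun f hf => ?_
  obtain ⟨V, hV, -, hVU⟩ :=
    lebesgue_number_of_compact_open (hB f) hU (mapsTo_iff_image_subset.1 hf)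
  filter_upwards [le_uniformOnTopology_iff.1 le_rfl f A hA V hV] with g hg x hx
  exact hVU _ (mem_image_of_mem f hx) (hg x (hBA hx))

/-- Small translates of `f` are uniformly close to `f`. -/
lemma tendsto_add_const_uniformOnTopology (f : C(X, ι → ℝ)) :
    Tendsto (fun c : ι → ℝ => f + ContinuousMap.const X c) (𝓝 0)
      (@nhds _ (uniformOnTopology ι Λ) f) := by
  refine tendsto_uniformOnTopology_iff.2 fun A _ V hV => ?_
  rw [uniformity_eq_comap_nhds_zero] at hV
  obtain ⟨W, hW, hWV⟩ := hV
  filter_upwards [hW] with c hc x _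
  exact hWV (by simpa using hc)

lemma isClosed_image_of_isOpen_mapsTo {A : Set X}
    (h : ∀ U : Set (ι → ℝ), IsOpen U →
      IsOpen[uniformOnTopology ι Λ] {f : C(X, ι → ℝ) | MapsTo f A U})
    (f : C(X, ι → ℝ)) : IsClosed (f '' A) := by
  refine isClosed_of_closure_subset fun p hp => ?_
  by_contra hpA
  have hf : ∀ᶠ g : C(X, ι → ℝ) in @nhds _ (uniformOnTopology ι Λ) f, MapsTo g A {p}ᶜ :=
    @IsOpen.mem_nhds _ (uniformOnTopology ι Λ) f _ (h _ isOpen_compl_singleton)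
      fun x hx hxp => hpA ⟨x, hx, hxp⟩
  have hsub : Tendsto (fun y : ι → ℝ => p - y) (𝓝 p) (𝓝 0) := by
    have : Continuous fun y : ι → ℝ => p - y := by fun_prop
    simpa using this.tendsto p
  obtain ⟨_, ⟨x, hx, rfl⟩, hy⟩ := ((mem_closure_iff_frequently.1 hp).and_eventually
    (((tendsto_add_const_uniformOnTopology f).comp hsub).eventually hf)).exists
  exact hy hx (by simp)

/-- Real functions may be regarded as `ι → ℝ`-valued ones with equal coordinates. -/
lemma isClosed_real_image_of_isClosed_image [Nonempty ι] {A : Set X}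
    (h : ∀ f : C(X, ι → ℝ), IsClosed (f '' A)) {φ : X → ℝ} (hφ : Continuous φ) :
    IsClosed (φ '' A) := by
  have := (h ⟨fun x _ => φ x, by fun_prop⟩).preimage
    (show Continuous fun (t : ℝ) (_ : ι) => t by fun_prop)
  convert this using 1
  ext t
  simp [funext_iff]

lemma cCompactIn_of_isClosed_image [Nonempty ι] {A : Set X}
    (h : ∀ f : C(X, ι → ℝ), IsClosed (f '' A)) : CCompactIn ι A := by
  intro f
  have hbdd : ∀ i, ∃ M, ∀ x ∈ A, |f x i| ≤ M := by
    intro i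
    by_contra! hM
    have hφ : Continuous fun x => (1 + |f x i|)⁻¹ :=
      (show Continuous fun x => 1 + |f x i| by fun_prop).inv₀ fun x => by positivity
    have hmem : (0 : ℝ) ∈ closure ((fun x => (1 + |f x i|)⁻¹) '' A) := by
      refine Metric.mem_closure_iff.2 fun ε hε => ?_
      obtain ⟨x, hx, hxM⟩ := hM ε⁻¹
      refine ⟨_, mem_image_of_mem _ hx, ?_⟩
      rw [dist_zero_left, Real.norm_of_nonneg (by positivity)]
      exact inv_lt_of_inv_lt₀ hε (by linarith)
    rw [(isClosed_real_image_of_isClosed_image h hφ).closure_eq] at hmem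
    obtain ⟨x, -, hx⟩ := hmem
    have : (0 : ℝ) < (1 + |f x i|)⁻¹ := by positivity
    exact this.ne' hx
  choose M hM using hbdd
  refine (isCompact_univ_pi fun i => isCompact_Icc (a := -M i) (b := M i)).of_isClosed_subset
    (h f) ?_
  rintro _ ⟨x, hx, rfl⟩ i -
  exact abs_le.1 (hM i x hx)

/-- The trace of a zero set on a `C_ι`-compact set is `C_ι`-compact. -/
lemma CCompactIn.inter_zeroLocus [Nonempty ι] {A : Set X} (hA : CCompactIn ι A) {φ : X → ℝ}
    (hφ : Continuous φ) : CCompactIn ι (A ∩ {x | φ x = 0}) := by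
  intro g
  cases finite_or_infinite ι with
  | inl hι =>
    have := Fintype.ofFinite ι
    refine (hA g).of_isClosed_subset (isClosed_of_closure_subset fun p hp => ?_)
      (image_mono inter_subset_left)
    have hψ : Continuous fun x => dist p (g x) + |φ x| := by fun_prop
    have hmem : (0 : ℝ) ∈ closure ((fun x => dist p (g x) + |φ x|) '' A) := by
      refine Metric.mem_closure_iff.2 fun ε hε => ?_
      obtain ⟨_, ⟨x, ⟨hxA, hx⟩, rfl⟩, hxp⟩ := Metric.mem_closure_iff.1 hp ε hε
      refine ⟨_, mem_image_of_mem _ hxA, ?_⟩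
      have hx : φ x = 0 := hx
      simpa [hx] using hxp
    rw [(isClosed_real_image_of_isClosed_image (fun f => (hA f).isClosed) hψ).closure_eq] at hmem
    obtain ⟨x, hxA, hx⟩ := hmem
    have hx : dist p (g x) + |φ x| = 0 := hx
    have h₁ : 0 ≤ dist p (g x) := dist_nonneg
    have h₂ := abs_nonneg (φ x)
    exact ⟨x, ⟨hxA, abs_eq_zero.1 (by linarith)⟩, (dist_eq_zero.1 (by linarith)).symm⟩
  | inr hι =>
    obtain ⟨e⟩ : Nonempty (Option ι ≃ ι) := by
      rw [← Cardinal.eq, Cardinal.mk_option, Cardinal.add_one_of_aleph0_le]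
      exact Cardinal.aleph0_le_mk ι
    let h : C(X, ι → ℝ) :=
      ⟨fun x i => (e.symm i).elim (φ x) (g x), continuous_pi fun i => by
        cases e.symm i <;> simp only [Option.elim] <;> fun_prop⟩
    have hK : IsCompact (h '' A ∩ {y | y (e none) = 0}) :=
      (hA h).inter_right (isClosed_eq (by fun_prop) continuous_const)
    convert hK.image (show Continuous fun (y : ι → ℝ) i => y (e (some i)) by fun_prop) using 1
    ext p
    constructor
    · rintro ⟨x, ⟨hxA, hx⟩, rfl⟩
      exact ⟨h x, ⟨mem_image_of_mem h hxA, by simpa [h] using hx⟩, by ext i; simp [h]⟩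
    · rintro ⟨_, ⟨⟨x, hxA, rfl⟩, hx⟩, rfl⟩
      exact ⟨x, ⟨hxA, by simpa [h] using hx⟩, by ext i; simp [h]⟩

lemma setOpenTopology_le_uniformOnTopology [Nonempty ι] (hc : ∀ A ∈ Λ, CCompactIn ι A)
    (hΛ : Λ = lambdaC ι Λ) : setOpenTopology ι Λ ≤ uniformOnTopology ι Λ := by
  let _ := setOpenTopology (X := X) ι Λ
  refine le_uniformOnTopology_iff.2 fun f A hA => ?_
  have hAΛ := hA
  rw [hΛ] at hAΛ
  suffices H : ∀ i, ∀ ε > 0, ∀ᶠ g : C(X, ι → ℝ) in 𝓝 f, ∀ x ∈ A, dist (f x i) (g x i) < ε by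
    rw [tendstoUniformlyOn_iff_tendsto, Pi.uniformity, tendsto_iInf]
    intro i
    rw [tendsto_comap_iff]
    exact tendstoUniformlyOn_iff_tendsto.1 (Metric.tendstoUniformlyOn_iff.2 (H i))
  intro i ε hε
  have hcpt : IsCompact ((fun x => f x i) '' A) := by
    simpa only [image_image] using (hc A hA f).image (continuous_apply i)
  obtain ⟨T, -, hT, hAT⟩ := hcpt.finite_cover_balls (e := ε / 3) (by positivity)
  have hev : ∀ t ∈ T, ∀ᶠ g : C(X, ι → ℝ) in 𝓝 f,
      MapsTo g (A ∩ {x | max (dist (f x i) t - ε / 3) 0 = 0}) {y | dist (y i) t < ε / 2} := by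
    intro t _
    refine (hAΛ.2 _ inter_subset_left ((hc A hA).inter_zeroLocus (by fun_prop)) _
      (isOpen_lt (by fun_prop) continuous_const)).mem_nhds ?_
    rintro x ⟨-, hx⟩
    have hx : dist (f x i) t - ε / 3 ≤ 0 := max_eq_right_iff.1 hx
    show dist (f x i) t < ε / 2
    linarith
  filter_upwards [(eventually_all_finite hT).2 hev] with g hg x hx
  obtain ⟨t, ht, hxt⟩ := mem_iUnion₂.1 (hAT (mem_image_of_mem _ hx))
  have hxt : dist (f x i) t < ε / 3 := hxt
  have hgt : dist (g x i) t < ε / 2 := hg t ht ⟨hx, max_eq_right (by linarith)⟩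
  linarith [dist_triangle_right (f x i) (g x i) t]

end

open UniformConvergence in
theorem statement_8 {X : Type*} [TopologicalSpace X] [T35Space X]
    (ι : Type*) [Nonempty ι] (Λ : Set (Set X)) (hΛ : ∀ A ∈ Λ, A.Nonempty) :
    setOpenTopology ι Λ =
      TopologicalSpace.induced
        (fun f : C(X, ι → ℝ) => UniformOnFun.ofFun Λ ⇑f)
        (UniformOnFun.topologicalSpace X (ι → ℝ) Λ) ↔
    (∀ A ∈ Λ, CCompactIn ι A) ∧ Λ = lambdaC ι Λ := by
  constructor
  · intro h
    change setOpenTopology ι Λ = uniformOnTopology ι Λ at h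
    refine ⟨fun A hA => cCompactIn_of_isClosed_image <|
        isClosed_image_of_isOpen_mapsTo (Λ := Λ) fun U hU => ?_,
      Subset.antisymm (fun A hA => ⟨hA, fun B hBA hB U hU => ?_⟩) fun A hA => hA.1⟩
    · rw [← h]
      exact TopologicalSpace.isOpen_generateFrom_of_mem ⟨A, hA, U, hU, rfl⟩
    · rw [h]
      exact isOpen_uniformOnTopology_mapsTo hA hBA hB hU
  · rintro ⟨hc, hΛC⟩
    refine le_antisymm (setOpenTopology_le_uniformOnTopology hc hΛC) ?_
    refine le_generateFrom ?_
    rintro _ ⟨A, hA, U, hU, rfl⟩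
    exact isOpen_uniformOnTopology_mapsTo hA subset_rfl (hc A hA) hU
end

section
/- The maximal family λ_m := {A ⊆ X : A nonempty and [A,U] ∈ τ_λ for every open U ⊆ ℝ^ι} is a saturation family consisting of C_ι-compact subsets of X (i.e., every member of λ_m is C_ι-compact, and whenever A ∈ λ_m and Z is an ℝ^ι-zero-set of X with A ∩ Z nonempty, then A ∩ Z ∈ λ_m) if and only if every member of λ is C_ι-compact in X and λ = λ(C_ι). -/
open Topology Set

/-- The maximal family `λ_m`: all nonempty `A ⊆ X` such that `[A,U]` is `τ_λ`-open for
every open `U ⊆ ℝ^ι`. -/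
def lambdaM {X : Type*} [TopologicalSpace X] (ι : Type*) (Λ : Set (Set X)) : Set (Set X) :=
  {A | A.Nonempty ∧ ∀ U : Set (ι → ℝ), IsOpen U →
    IsOpen[setOpenTopology ι Λ] {f : C(X, ι → ℝ) | Set.MapsTo f A U}}

/-- An `ℝ^ι`-zero-set of `X`: a preimage under a continuous map `X → ℝ^ι` of a zero-set
of `ℝ^ι` (a set of the form `g⁻¹({0})` for a continuous `g : ℝ^ι → ℝ`). -/
def IsRIZeroSet {X : Type*} [TopologicalSpace X] (ι : Type*) (Z : Set X) : Prop :=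
  ∃ f : X → (ι → ℝ), Continuous f ∧ ∃ g : (ι → ℝ) → ℝ, Continuous g ∧ Z = f ⁻¹' (g ⁻¹' {0})

section Separation

variable {X : Type*} [TopologicalSpace X]

theorem IsCompact.exists_continuousMap_eq_zero [CompletelyRegularSpace X] {K U : Set X}
    (hK : IsCompact K) (hU : IsOpen U) (hKU : K ⊆ U) :
    ∃ g : C(X, ℝ), (∀ x ∈ K, g x = 0) ∧ ∀ x, g x = 0 → x ∈ U := by
  refine hK.induction_on (p := fun s => ∃ g : C(X, ℝ), (∀ x ∈ s, g x = 0) ∧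
    ∀ x, g x = 0 → x ∈ U) ⟨1, by simp⟩ ?_ ?_ ?_
  · rintro s t hst ⟨g, hg, hgU⟩
    exact ⟨g, fun x hx => hg x (hst hx), hgU⟩
  · rintro s t ⟨g, hg, hgU⟩ ⟨k, hk, hkU⟩
    refine ⟨g * k, ?_, ?_⟩
    · rintro x (hx | hx)
      · simp [hg x hx]
      · simp [hk x hx]
    · intro x hx
      rcases mul_eq_zero.1 hx with h | h
      · exact hgU x h
      · exact hkU x h
  · intro x hx
    obtain ⟨φ, hφ, hφ0, hφ1⟩ :=
      CompletelyRegularSpace.completely_regular_isOpen x U hU (hKU hx)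
    have hφ' : Continuous fun y => (φ y : ℝ) := continuous_subtype_val.comp hφ
    refine ⟨{y | (φ y : ℝ) < 1 / 2}, mem_nhdsWithin_of_mem_nhds
      ((isOpen_lt hφ' continuous_const).mem_nhds (by simp [hφ0])),
      ⟨fun y => max ((φ y : ℝ) - 1 / 2) 0, by fun_prop⟩, ?_, ?_⟩
    · intro y hy
      exact max_eq_right (sub_nonpos.2 (le_of_lt hy))
    · intro y hy
      by_contra hyU
      have h1 : (φ y : ℝ) = 1 := by simp [hφ1 hyU]
      have h2 : max ((φ y : ℝ) - 1 / 2) 0 = 0 := hy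
      rw [h1] at h2
      norm_num at h2

end Separation

section CCompact

variable {X : Type*} [TopologicalSpace X] {ι : Type*} {A B : Set X}

theorem CCompactIn.sUnion {S : Set (Set X)} (hS : S.Finite) (h : ∀ A ∈ S, CCompactIn ι A) :
    CCompactIn ι (⋃₀ S) := by
  intro f
  rw [sUnion_eq_biUnion, image_iUnion₂]
  exact hS.isCompact_biUnion fun A hA => h A hA f

theorem CCompactIn.apply_mem_image (hB : CCompactIn ι B) (f : C(X, ι → ℝ)) {x : X}
    (hx : x ∈ closure B) : f x ∈ f '' B :=
  (hB f).isClosed.closure_subset (image_closure_subset_closure_image f.continuous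
    (mem_image_of_mem f hx))

variable [Nonempty ι]

theorem CCompactIn.isCompact_image_real_s9 (hB : CCompactIn ι B) (h : C(X, ℝ)) :
    IsCompact (h '' B) := by
  obtain ⟨i⟩ := ‹Nonempty ι›
  have := (hB ⟨fun x _ => h x, by fun_prop⟩).image (continuous_apply (A := fun _ : ι => ℝ) i)
  rwa [image_image] at this

theorem CCompactIn.mem_image_real (hB : CCompactIn ι B) (h : C(X, ℝ)) {y : ℝ}
    (hy : y ∈ closure (h '' B)) : y ∈ h '' B :=
  (hB.isCompact_image_real_s9 h).isClosed.closure_subset hy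

theorem CCompactIn.inter_zero (hB : CCompactIn ι B) (h : C(X, ℝ)) :
    CCompactIn ι (B ∩ {x | h x = 0}) := by
  intro f
  rcases finite_or_infinite ι with hι | hι
  · have := Fintype.ofFinite ι
    refine (hB f).of_isClosed_subset (isClosed_of_closure_subset fun y hy => ?_)
      (image_mono inter_subset_left)
    have h0 := image_closure_subset_closure_image (f := fun z : ι → ℝ => ‖z - y‖)
      (by fun_prop) (mem_image_of_mem _ hy)
    let k : C(X, ℝ) := ⟨fun x => ‖f x - y‖ + |h x|, by fun_prop⟩
    have hk : (0 : ℝ) ∈ closure (k '' B) := by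
      simp only [sub_self, norm_zero] at h0
      refine closure_mono ?_ h0
      rintro _ ⟨_, ⟨x, ⟨hxB, hx⟩, rfl⟩, rfl⟩
      exact ⟨x, hxB, by simp [k, show h x = 0 from hx]⟩
    obtain ⟨x, hxB, hx⟩ := hB.mem_image_real k hk
    obtain ⟨h1, h2⟩ := (add_eq_zero_iff_of_nonneg (norm_nonneg _) (abs_nonneg _)).1 hx
    exact ⟨x, ⟨hxB, abs_eq_zero.1 h2⟩, sub_eq_zero.1 (norm_eq_zero.1 h1)⟩
  · obtain ⟨e⟩ : Nonempty (ι ≃ Option ι) := Cardinal.eq.1 (by simp)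
    let F : C(X, ι → ℝ) := ⟨fun x i => (e i).elim (h x) (f x), by
      refine continuous_pi fun i => ?_
      rcases e i with _ | j <;> simp only [Option.elim] <;> fun_prop⟩
    have hc := ((hB F).inter_right (t := {v : ι → ℝ | v (e.symm none) = 0})
      (isClosed_eq (continuous_apply _) continuous_const)).image
      (f := fun (v : ι → ℝ) i => v (e.symm (some i))) (by fun_prop)
    convert! hc using 1
    ext y
    constructor
    · rintro ⟨x, ⟨hxB, hx⟩, rfl⟩
      exact ⟨F x, ⟨mem_image_of_mem F hxB, by simpa [F] using hx⟩, by simp [F]⟩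
    · rintro ⟨_, ⟨⟨x, hxB, rfl⟩, hx⟩, rfl⟩
      exact ⟨x, ⟨hxB, by simpa [F] using hx⟩, by simp [F]⟩

theorem CCompactIn.mem_closure_inter_zero [CompletelyRegularSpace X] (hB : CCompactIn ι B)
    (h : C(X, ℝ)) {x : X} (hx : x ∈ closure B) (hx0 : h x = 0) :
    x ∈ closure (B ∩ {x | h x = 0}) := by
  by_contra hn
  obtain ⟨φ, hφ, hφ0, hφ1⟩ := CompletelyRegularSpace.completely_regular x _ isClosed_closure hn
  let k : C(X, ℝ) := ⟨fun x => |h x| + (φ x : ℝ), by fun_prop⟩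
  have hk := image_closure_subset_closure_image k.continuous (mem_image_of_mem k hx)
  obtain ⟨b, hbB, hb⟩ := hB.mem_image_real k hk
  have hb' : |h b| + (φ b : ℝ) = 0 := hb.trans (by simp [k, hx0, hφ0])
  obtain ⟨h1, h2⟩ := (add_eq_zero_iff_of_nonneg (abs_nonneg _) (φ b).2.1).1 hb'
  have h3 := hφ1 (subset_closure ⟨hbB, abs_eq_zero.1 h1⟩)
  simp [h3] at h2

end CCompact

section SetOpen

variable {X : Type*} [TopologicalSpace X] {ι : Type*} {Λ : Set (Set X)}

theorem isOpen_setOpenTopology {A : Set X} (hA : A ∈ Λ) {U : Set (ι → ℝ)} (hU : IsOpen U) :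
    IsOpen[setOpenTopology ι Λ] {f : C(X, ι → ℝ) | MapsTo f A U} :=
  TopologicalSpace.isOpen_generateFrom_of_mem ⟨A, hA, U, hU, rfl⟩

theorem subset_lambdaM (hΛ : ∀ A ∈ Λ, A.Nonempty) : Λ ⊆ lambdaM ι Λ :=
  fun A hA => ⟨hΛ A hA, fun _ hU => isOpen_setOpenTopology hA hU⟩

theorem exists_finite_of_isOpen_setOpenTopology {O : Set C(X, ι → ℝ)}
    (hO : IsOpen[setOpenTopology ι Λ] O) {f : C(X, ι → ℝ)} (hf : f ∈ O) :
    ∃ T : Set (Set X × Set (ι → ℝ)), T.Finite ∧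
      (∀ p ∈ T, p.1 ∈ Λ ∧ IsOpen p.2 ∧ MapsTo f p.1 p.2) ∧
      ∀ g : C(X, ι → ℝ), (∀ p ∈ T, MapsTo g p.1 p.2) → g ∈ O := by
  induction hO with
  | basic s hs =>
    obtain ⟨A, hA, U, hU, rfl⟩ := hs
    exact ⟨{(A, U)}, finite_singleton _, by simpa using ⟨hA, hU, hf⟩, by simp⟩
  | univ => exact ⟨∅, finite_empty, by simp, by simp⟩
  | inter s t _ _ hs ht =>
    obtain ⟨S, hSf, hS, hS'⟩ := hs hf.1
    obtain ⟨T, hTf, hT, hT'⟩ := ht hf.2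
    refine ⟨S ∪ T, hSf.union hTf, ?_, fun g hg => ⟨hS' g fun p hp => hg p (.inl hp),
      hT' g fun p hp => hg p (.inr hp)⟩⟩
    rintro p (hp | hp)
    exacts [hS p hp, hT p hp]
  | sUnion S _ ih =>
    obtain ⟨s, hs, hfs⟩ := hf
    obtain ⟨T, hTf, hT, hT'⟩ := ih s hs hfs
    exact ⟨T, hTf, hT, fun g hg => ⟨s, hs, hT' g hg⟩⟩

theorem exists_finite_subset_closure_of_mem_lambdaM [CompletelyRegularSpace X] [Nonempty ι]
    {A : Set X} (hA : A ∈ lambdaM ι Λ) :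
    ∃ S ⊆ Λ, S.Finite ∧ A ⊆ closure (⋃₀ S) := by
  obtain ⟨i⟩ := ‹Nonempty ι›
  obtain ⟨T, hTf, hT, hT'⟩ := exists_finite_of_isOpen_setOpenTopology
    (hA.2 {v | v i < 1} (isOpen_lt (continuous_apply i) continuous_const))
    (f := 0) (fun x _ => by simp)
  refine ⟨Prod.fst '' T, ?_, hTf.image _, fun a ha => ?_⟩
  · rintro _ ⟨p, hp, rfl⟩
    exact (hT p hp).1
  by_contra hn
  obtain ⟨φ, hφ, hφ0, hφ1⟩ := CompletelyRegularSpace.completely_regular a _ isClosed_closure hn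
  let g : C(X, ι → ℝ) := ⟨fun x _ => 1 - (φ x : ℝ), by fun_prop⟩
  have hg := hT' g (fun p hp x hx => by
    have h1 := hφ1 (subset_closure (mem_sUnion_of_mem hx (mem_image_of_mem Prod.fst hp)))
    have h0 : g x = 0 := by
      ext j
      simp [g, h1]
    rw [h0]
    exact (hT p hp).2.2 hx)
  have := hg ha
  simp [g, hφ0] at this

theorem CCompactIn.of_mem_lambdaM [CompletelyRegularSpace X] [Nonempty ι]
    (hΛ : ∀ A ∈ Λ, CCompactIn ι A) {A : Set X} (hA : A ∈ lambdaM ι Λ) : CCompactIn ι A := by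
  intro f
  obtain ⟨S, hSΛ, hSf, hAS⟩ := exists_finite_subset_closure_of_mem_lambdaM hA
  have hS : CCompactIn ι (⋃₀ S) := CCompactIn.sUnion hSf fun B hB => hΛ B (hSΛ hB)
  refine (hS f).of_isClosed_subset (isClosed_of_closure_subset fun y hy => ?_) ?_
  · by_contra hyA
    obtain ⟨T, hTf, hT, hT'⟩ := exists_finite_of_isOpen_setOpenTopology
      (hA.2 {y}ᶜ isOpen_compl_singleton) (f := f)
      (fun x hx hxy => hyA ⟨x, hx, hxy⟩)
    have hev : ∀ᶠ c in 𝓝 (0 : ι → ℝ), ∀ p ∈ T, ∀ x ∈ p.1, f x + c ∈ p.2 := by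
      refine hTf.eventually_all.2 fun p hp => ?_
      obtain ⟨hpΛ, hpo, hpf⟩ := hT p hp
      obtain ⟨V, hV, hVU⟩ := compact_open_separated_add_right (hΛ _ hpΛ f) hpo hpf.image_subset
      filter_upwards [hV] with c hc x hx
      exact hVU (add_mem_add (mem_image_of_mem f hx) hc)
    have hsub : Filter.Tendsto (fun z : ι → ℝ => y - z) (𝓝 y) (𝓝 0) := by
      simpa using (tendsto_const_nhds (x := y)).sub (Filter.tendsto_id (x := 𝓝 y))
    obtain ⟨_, ha', ⟨a, ha, rfl⟩⟩ := mem_closure_iff_nhds.1 hy _ (hsub.eventually hev)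
    have := hT' ⟨fun x => f x + (y - f a), by fun_prop⟩ (fun p hp x hx => ha' p hp x hx) ha
    exact this (by simp)
  · rintro _ ⟨x, hx, rfl⟩
    exact hS.apply_mem_image f (hAS hx)

theorem inter_zero_mem_lambdaM [CompletelyRegularSpace X] [Nonempty ι]
    (hc : ∀ A ∈ Λ, CCompactIn ι A) (hΛ : Λ = lambdaC ι Λ) {A : Set X}
    (hA : A ∈ lambdaM ι Λ) (h : C(X, ℝ)) (hne : (A ∩ {x | h x = 0}).Nonempty) :
    A ∩ {x | h x = 0} ∈ lambdaM ι Λ := by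
  refine ⟨hne, fun U hU => (@isOpen_iff_forall_mem_open _ (setOpenTopology ι Λ) _).2
    fun f hf => ?_⟩
  obtain ⟨S, hSΛ, hSf, hAS⟩ := exists_finite_subset_closure_of_mem_lambdaM hA
  obtain ⟨g, hg, hgU⟩ := (((CCompactIn.of_mem_lambdaM hc hA).inter_zero h)
    f).exists_continuousMap_eq_zero hU (image_subset_iff.2 hf)
  let k : C(X, ℝ) := ⟨fun x => |h x| + |g (f x)|, by fun_prop⟩
  have hk : ∀ x, k x = 0 ↔ h x = 0 ∧ g (f x) = 0 := fun x => by
    simpa [k] using add_eq_zero_iff_of_nonneg (abs_nonneg (h x)) (abs_nonneg (g (f x)))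
  refine ⟨⋂ B ∈ S, {f' : C(X, ι → ℝ) | MapsTo f' (B ∩ {x | k x = 0}) U}, ?_, ?_, ?_⟩
  · intro f' hf' x hx
    have hkx : k x = 0 := (hk x).2 ⟨hx.2, hg _ (mem_image_of_mem f hx)⟩
    have hxS := hAS hx.1
    rw [sUnion_eq_biUnion, hSf.closure_biUnion] at hxS
    obtain ⟨B, hB, hxB⟩ := mem_iUnion₂.1 hxS
    have hBc := hc B (hSΛ hB)
    obtain ⟨b, hb, hbx⟩ := (hBc.inter_zero k).apply_mem_image f'
      (hBc.mem_closure_inter_zero k hxB hkx)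
    exact hbx ▸ mem_iInter₂.1 hf' B hB hb
  · refine @Set.Finite.isOpen_biInter _ _ (setOpenTopology ι Λ) _ _ hSf fun B hB => ?_
    have hB' := hSΛ hB
    have hBC : B ∈ lambdaC ι Λ := hΛ ▸ hB'
    exact hBC.2 _ inter_subset_left ((hc B hB').inter_zero k) U hU
  · exact mem_iInter₂.2 fun B _ x hx => hgU _ ((hk x).1 hx.2).2

theorem eq_lambdaC_of_inter_mem_lambdaM (hsub : Λ ⊆ lambdaM ι Λ)
    (hsat : ∀ A ∈ lambdaM ι Λ, ∀ Z : Set X, IsRIZeroSet ι Z → (A ∩ Z).Nonempty →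
      A ∩ Z ∈ lambdaM ι Λ) : Λ = lambdaC ι Λ := by
  refine Subset.antisymm (fun A hA => ⟨hA, fun B hBA hB U hU => ?_⟩) fun A hA => hA.1
  refine (@isOpen_iff_forall_mem_open _ (setOpenTopology ι Λ) _).2 fun f hf => ?_
  rcases B.eq_empty_or_nonempty with rfl | hne
  · exact ⟨univ, fun f' _ => mapsTo_empty f' U, @isOpen_univ _ (setOpenTopology ι Λ), trivial⟩
  obtain ⟨g, hg, hgU⟩ := (hB f).exists_continuousMap_eq_zero hU (image_subset_iff.2 hf)
  have hBZ : B ⊆ A ∩ f ⁻¹' (g ⁻¹' {0}) := fun x hx => ⟨hBA hx, hg _ (mem_image_of_mem f hx)⟩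
  exact ⟨_, fun f' hf' => hf'.mono_left hBZ,
    (hsat A (hsub hA) _ ⟨f, f.continuous, g, g.continuous, rfl⟩ (hne.mono hBZ)).2 U hU,
    fun x hx => hgU _ hx.2⟩

end SetOpen

theorem statement_9 {X : Type*} [TopologicalSpace X] [T35Space X]
    (ι : Type*) [Nonempty ι] (Λ : Set (Set X)) (hΛ : ∀ A ∈ Λ, A.Nonempty) :
    ((∀ A ∈ lambdaM ι Λ, CCompactIn ι A) ∧
      ∀ A ∈ lambdaM ι Λ, ∀ Z : Set X, IsRIZeroSet ι Z → (A ∩ Z).Nonempty →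
        A ∩ Z ∈ lambdaM ι Λ) ↔
    (∀ A ∈ Λ, CCompactIn ι A) ∧ Λ = lambdaC ι Λ := by
  constructor
  · rintro ⟨hc, hsat⟩
    have hsub := subset_lambdaM (ι := ι) hΛ
    exact ⟨fun A hA => hc A (hsub hA), eq_lambdaC_of_inter_mem_lambdaM hsub hsat⟩
  · rintro ⟨hc, hC⟩
    refine ⟨fun A hA => CCompactIn.of_mem_lambdaM hc hA, ?_⟩
    rintro A hA _ ⟨f, hf, g, hg, rfl⟩ hne
    exact inter_zero_mem_lambdaM hc hC hA ⟨g ∘ f, hg.comp hf⟩ hne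
end
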